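/- arXiv:1803.03945 — 4 statements merged into one kernel-verified Lean document; each statement's English description precedes it below -/
import Mathlib

section
/- Let a : ℕ × ℕ → ℚ be any function satisfying the BC recursive relations: a(0,0) = 1; a(n,n) = 0 for all n ≥ 1; a(n,0) = a(n−1,0) + a(n,1) for all n ≥ 1; and a(n,m) = a(n−1,m−1) + a(n,m+1) for all n, m with 1 ≤ m ≤ n−1. Then for all n ≥ 1 and all m with 0 ≤ m ≤ n−1, a(n,m) equals the ballot number N(n, n−1−m); equivalently, (2n−m)·a(n,m) = (m+2)·C(2n−m, n−1−m). -/
/-- The ballot number `N(i,j) = ((i+1-j) * C(i+1+j, j)) / (i+1+j)`. -/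
def ballot (i j : ℕ) : ℕ := ((i + 1 - j) * Nat.choose (i + 1 + j) j) / (i + 1 + j)

/-- Clearing the denominator of the ballot number `N(m + k + 1, k)`. -/
theorem ballot_choose_identity (m k : ℕ) :
    ((m : ℤ) + 2 * k + 2) * (2 * (m + 2 * k + 1).choose k - (m + 2 * k + 2).choose k)
      = (m + 2) * (m + 2 * k + 2).choose k := by
  have h := Nat.choose_mul_succ_eq (m + 2 * k + 1) k
  rw [show m + 2 * k + 1 + 1 - k = m + k + 2 by omega] at h
  zify at h
  rw [show m + 2 * k + 1 + 1 = m + 2 * k + 2 from rfl] at h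
  linear_combination 2 * h

theorem ballot_eq_sub_choose (m k : ℕ) :
    (ballot (m + k + 1) k : ℚ) = 2 * (m + 2 * k + 1).choose k - (m + 2 * k + 2).choose k := by
  have h := ballot_choose_identity m k
  have hz : ((ballot (m + k + 1) k : ℕ) : ℤ)
      = 2 * (m + 2 * k + 1).choose k - (m + 2 * k + 2).choose k := by
    unfold ballot
    rw [show m + k + 1 + 1 - k = m + 2 by omega,
      show m + k + 1 + 1 + k = m + 2 * k + 2 by omega]
    push_cast
    rw [← h]
    exact Int.mul_ediv_cancel_left _ (by omega)
  exact_mod_cast congrArg (Int.cast : ℤ → ℚ) hz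

/-- The solution of the BC recursive relations as a difference of binomial coefficients. -/
theorem bc_relation_eq_sub_choose (a : ℕ × ℕ → ℚ)
    (h00 : a (0, 0) = 1)
    (hnn : ∀ n : ℕ, 1 ≤ n → a (n, n) = 0)
    (h0 : ∀ n : ℕ, 1 ≤ n → a (n, 0) = a (n - 1, 0) + a (n, 1))
    (hrec : ∀ n m : ℕ, 1 ≤ m → m ≤ n - 1 → a (n, m) = a (n - 1, m - 1) + a (n, m + 1))
    (k m : ℕ) :
    a (m + k + 1, m) = 2 * (m + 2 * k + 1).choose k - (m + 2 * k + 2).choose k := by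
  induction k generalizing m with
  | zero =>
    induction m with
    | zero =>
      have h := h0 1 le_rfl
      norm_num [h00, hnn 1 le_rfl] at h ⊢
      exact h
    | succ m ih =>
      have h := hrec (m + 2) (m + 1) (by omega) (by omega)
      rw [hnn (m + 1 + 1) (by omega)] at h
      simp only [Nat.choose_zero_right] at ih ⊢
      change a (m + 2, m + 1) = _
      rw [h]
      simpa using ih
  | succ k ihk =>
    induction m with
    | zero =>
      have h := h0 (k + 2) (by omega)
      have e0 := ihk 0
      have e1 := ihk 1
      rw [show 1 + k + 1 = k + 2 by omega, show 1 + 2 * k + 1 = 2 * k + 2 by omega,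
        show 1 + 2 * k + 2 = 2 * k + 3 by omega] at e1
      simp only [zero_add] at e0 ⊢
      change a (k + 1, 0) = _ at e0
      change a (k + 2, 0) = a (k + 1, 0) + _ at h
      change a (k + 2, 0) = _
      rw [show 2 * (k + 1) + 1 = 2 * k + 3 by omega, show 2 * (k + 1) + 2 = 2 * k + 4 by omega,
        h, e0, e1]
      have p1 := Nat.choose_succ_succ' (2 * k + 1) k
      have p2 := Nat.choose_succ_succ' (2 * k + 2) k
      have p3 := Nat.choose_succ_succ' (2 * k + 3) k
      have s := Nat.choose_symm_half k
      qify at p1 p2 p3 s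
      linear_combination p3 - p2 - p1 - s
    | succ m ihm =>
      have h := hrec (m + k + 3) (m + 1) (by omega) (by omega)
      have e := ihk (m + 2)
      rw [show m + 2 + k + 1 = m + k + 3 by omega,
        show m + 2 + 2 * k + 1 = m + 2 * k + 3 by omega,
        show m + 2 + 2 * k + 2 = m + 2 * k + 4 by omega] at e
      change a (m + k + 3, m + 1) = a (m + (k + 1) + 1, m) + a (m + k + 3, m + 2) at h
      rw [show m + 1 + (k + 1) + 1 = m + k + 3 by omega, h, ihm, e,
        show m + 2 * (k + 1) + 1 = m + 2 * k + 3 by omega,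
        show m + 2 * (k + 1) + 2 = m + 2 * k + 4 by omega,
        show m + 1 + 2 * (k + 1) + 1 = m + 2 * k + 4 by omega,
        show m + 1 + 2 * (k + 1) + 2 = m + 2 * k + 5 by omega]
      have p1 := Nat.choose_succ_succ' (m + 2 * k + 3) k
      have p2 := Nat.choose_succ_succ' (m + 2 * k + 4) k
      qify at p1 p2
      linear_combination p2 - 2 * p1

/-- Any function satisfying the BC recursive relations agrees with the ballot numbers:
`a(n,m) = N(n, n-1-m)`; equivalently `(2n-m)·a(n,m) = (m+2)·C(2n-m, n-1-m)`. -/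
theorem bc_relation_eq_ballot (a : ℕ × ℕ → ℚ)
    (h00 : a (0, 0) = 1)
    (hnn : ∀ n : ℕ, 1 ≤ n → a (n, n) = 0)
    (h0 : ∀ n : ℕ, 1 ≤ n → a (n, 0) = a (n - 1, 0) + a (n, 1))
    (hrec : ∀ n m : ℕ, 1 ≤ m → m ≤ n - 1 → a (n, m) = a (n - 1, m - 1) + a (n, m + 1))
    (n m : ℕ) (hn : 1 ≤ n) (hm : m ≤ n - 1) :
    a (n, m) = (ballot n (n - 1 - m) : ℚ) ∧
      ((2 * n - m : ℕ) : ℚ) * a (n, m)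
        = ((m : ℚ) + 2) * (Nat.choose (2 * n - m) (n - 1 - m) : ℚ) := by
  obtain ⟨k, rfl⟩ : ∃ k, n = m + k + 1 := ⟨n - 1 - m, by omega⟩
  have ha := bc_relation_eq_sub_choose a h00 hnn h0 hrec k m
  rw [show m + k + 1 - 1 - m = k by omega, show 2 * (m + k + 1) - m = m + 2 * k + 2 by omega]
  refine ⟨ha.trans (ballot_eq_sub_choose m k).symm, ?_⟩
  rw [ha]
  exact_mod_cast congrArg (Int.cast : ℤ → ℚ) (ballot_choose_identity m k)
end

section
/- For all natural numbers i, j with 0 ≤ j ≤ i+1, the number (i+1+j) divides (i+1−j)·C(i+1+j, j); that is, the ballot number N(i,j) = ((i+1−j)·C(i+1+j, j))/(i+1+j) is a nonnegative integer. -/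
/-- For `0 ≤ j ≤ i+1`, `(i+1+j)` divides `(i+1-j)·C(i+1+j, j)`; i.e. the ballot number
`N(i,j) = ((i+1-j)·C(i+1+j, j))/(i+1+j)` is a nonnegative integer. -/
theorem ballot_number_is_integer (i j : ℕ) (h : j ≤ i + 1) :
    (i + 1 + j) ∣ (i + 1 - j) * Nat.choose (i + 1 + j) j := by
  cases j with
  | zero => simp
  | succ k =>
    obtain ⟨d, hd⟩ := Nat.exists_eq_add_of_le h
    have absorb := Nat.add_one_mul_choose_eq (i + 1 + k) k
    rw [hd, Nat.add_sub_cancel_left, ← hd, ← add_assoc]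
    have hsum : (i + 1 + k + 1) ∣ 2 * ((i + 1 + k + 1) * (i + 1 + k).choose k) +
        d * (i + 1 + k + 1).choose (k + 1) :=
      ⟨(i + 1 + k + 1).choose (k + 1), by rw [absorb, hd]; ring⟩
    exact (Nat.dvd_add_right ((dvd_mul_right _ _).mul_left 2)).mp hsum
end

section
/- Let F be the formal power series in two variables X, Y over ℚ whose coefficient of X^i Y^j equals 1 if (i,j) = (0,0), equals the ballot number N(i, i−1−j) if 0 ≤ j ≤ i−1, and equals 0 otherwise (this F is the generating function of the BC numbers a(i,j)). Let Cat(X) = Σ_{n≥0} C_n X^n be the generating function of the Catalan numbers, viewed as a power series in X alone. Then F·(1 − Y + X·Y²) = (1 − X·Y)·(Cat(X) − Y). (This is the denominator-cleared, square-root-free form of G(x,y) = (1−xy)(1−√(1−4x)−2xy)/(2x(1−y+xy²)), using the identity 1−√(1−4x) = 2x·Cat(x).) -/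
/-- The generating function `F` of the BC numbers: the coefficient of `X^i Y^j` is `1` when
`(i,j) = (0,0)`, is the ballot number `N(i, i−1−j)` when `0 ≤ j ≤ i−1`, and is `0` otherwise. -/
noncomputable def bcGenFun : MvPowerSeries (Fin 2) ℚ :=
  fun d : Fin 2 →₀ ℕ =>
    if d 0 = 0 ∧ d 1 = 0 then 1
    else if d 1 + 1 ≤ d 0 then (ballot (d 0) (d 0 - 1 - d 1) : ℚ)
    else 0

/-- The generating function of the Catalan numbers, viewed as a power series in `X` alone. -/
noncomputable def catGenFun : MvPowerSeries (Fin 2) ℚ :=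
  fun d : Fin 2 →₀ ℕ => if d 1 = 0 then (catalan (d 0) : ℚ) else 0

/-- The ballot numbers as differences of two binomial coefficients. -/
theorem ballot_succ_add_choose {i j : ℕ} (h : j ≤ i) :
    ballot i (j + 1) + (i + j + 1).choose j = (i + j + 1).choose (j + 1) := by
  obtain ⟨k, rfl⟩ := Nat.exists_eq_add_of_le h
  set n := j + k + j + 1
  have h₁ : (n + 1) * n.choose j = (n + 1).choose (j + 1) * (j + 1) :=
    Nat.add_one_mul_choose_eq n j
  have h₂ : n.choose (j + 1) * (n + 1) = (n + 1).choose (j + 1) * (n + 1 - (j + 1)) :=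
    Nat.choose_mul_succ_eq n (j + 1)
  have h₃ : n + 1 - (j + 1) = k + j + 1 := by omega
  rw [h₃] at h₂
  have hle : n.choose j ≤ n.choose (j + 1) := by
    refine le_of_mul_le_mul_left ?_ n.succ_pos
    nlinarith
  have hb : ballot (j + k) (j + 1) = n.choose (j + 1) - n.choose j := by
    have e₁ : j + k + 1 - (j + 1) = k := by omega
    have e₂ : j + k + 1 + (j + 1) = n + 1 := by omega
    rw [ballot, e₁, e₂]
    refine Nat.div_eq_of_eq_mul_right n.succ_pos ?_
    zify [hle] at h₁ h₂ ⊢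
    linarith
  omega

theorem ballot_zero (i : ℕ) : ballot i 0 = 1 := by
  simp [ballot]

theorem ballot_self_succ (i : ℕ) : ballot i (i + 1) = 0 := by
  simp [ballot]

theorem ballot_succ_succ {i k : ℕ} (h : k ≤ i) :
    ballot (i + 1) (k + 1) = ballot (i + 1) k + ballot i (k + 1) := by
  have h₁ := ballot_succ_add_choose (i := i + 1) (j := k) (by omega)
  have h₂ := ballot_succ_add_choose h
  cases k with
  | zero =>
    simp only [zero_add, add_zero, Nat.choose_zero_right, Nat.choose_one_right] at h₁ h₂
    simp only [zero_add, ballot_zero]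
    omega
  | succ m =>
    have h₃ := ballot_succ_add_choose (i := i + 1) (j := m) (by omega)
    have e₁ : i + 1 + (m + 1) + 1 = i + m + 2 + 1 := by omega
    have e₂ : i + (m + 1) + 1 = i + m + 2 := by omega
    have e₃ : i + 1 + m + 1 = i + m + 2 := by omega
    rw [e₁, Nat.choose_succ_succ' _ m, Nat.choose_succ_succ' _ (m + 1)] at h₁
    rw [e₂] at h₂
    rw [e₃] at h₃
    omega

theorem ballot_self (i : ℕ) : ballot i i = catalan i := by
  have h₁ := Nat.choose_mul_succ_eq (2 * i) i
  have h₂ := succ_mul_catalan_eq_centralBinom i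
  have e₁ : 2 * i + 1 - i = i + 1 := by omega
  rw [e₁, ← Nat.centralBinom_eq_two_mul_choose, ← h₂] at h₁
  have e₂ : i + 1 - i = 1 := by omega
  have e₃ : i + 1 + i = 2 * i + 1 := by omega
  rw [ballot, e₂, e₃, one_mul]
  refine Nat.div_eq_of_eq_mul_right (by omega) (Nat.eq_of_mul_eq_mul_right i.succ_pos ?_)
  rw [Nat.succ_eq_add_one]
  linarith

theorem ballot_succ_self (i : ℕ) : ballot (i + 1) i = catalan (i + 1) := by
  rw [← ballot_self, ballot_succ_succ le_rfl, ballot_self_succ, add_zero]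

open MvPowerSeries in
theorem coeff_bcGenFun (d : Fin 2 →₀ ℕ) :
    coeff d bcGenFun = if d 0 = 0 ∧ d 1 = 0 then 1
      else if d 1 + 1 ≤ d 0 then (ballot (d 0) (d 0 - 1 - d 1) : ℚ) else 0 :=
  rfl

open MvPowerSeries in
theorem coeff_catGenFun (d : Fin 2 →₀ ℕ) :
    coeff d catGenFun = if d 1 = 0 then (catalan (d 0) : ℚ) else 0 :=
  rfl

/-- Denominator-cleared, square-root-free form of
`G(x,y) = (1−xy)(1−√(1−4x)−2xy)/(2x(1−y+xy²))`:
`F·(1 − Y + X·Y²) = (1 − X·Y)·(Cat(X) − Y)`. -/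
theorem bc_generating_function :
    bcGenFun * (1 - MvPowerSeries.X 1 + MvPowerSeries.X 0 * MvPowerSeries.X 1 ^ 2)
      = (1 - MvPowerSeries.X 0 * MvPowerSeries.X 1) * (catGenFun - MvPowerSeries.X 1) := by
  classical
  have hl : bcGenFun * (1 - MvPowerSeries.X 1 + MvPowerSeries.X 0 * MvPowerSeries.X 1 ^ 2)
      = bcGenFun - bcGenFun * MvPowerSeries.monomial (Finsupp.single 1 1) 1
        + bcGenFun * MvPowerSeries.monomial (Finsupp.single 0 1 + Finsupp.single 1 2) 1 := by
    rw [← one_mul (1 : ℚ), ← MvPowerSeries.monomial_mul_monomial, one_mul,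
      ← MvPowerSeries.X_pow_eq (n := 2), ← MvPowerSeries.X_def, ← MvPowerSeries.X_def]
    ring
  have hr : (1 - MvPowerSeries.X 0 * MvPowerSeries.X 1) * (catGenFun - MvPowerSeries.X 1)
      = catGenFun - MvPowerSeries.monomial (Finsupp.single 1 1) 1
        - catGenFun * MvPowerSeries.monomial (Finsupp.single 0 1 + Finsupp.single 1 1) 1
        + MvPowerSeries.monomial (Finsupp.single 0 1 + Finsupp.single 1 2) 1 := by
    rw [← one_mul (1 : ℚ), ← MvPowerSeries.monomial_mul_monomial,
      ← MvPowerSeries.monomial_mul_monomial, one_mul,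
      ← MvPowerSeries.X_pow_eq (n := 2), ← MvPowerSeries.X_def, ← MvPowerSeries.X_def]
    ring
  rw [hl, hr]
  ext d
  simp only [map_add, map_sub, MvPowerSeries.coeff_mul_monomial, MvPowerSeries.coeff_monomial,
    coeff_bcGenFun, coeff_catGenFun, Finsupp.le_def, Finsupp.ext_iff, Fin.forall_fin_two,
    Finsupp.add_apply, Finsupp.tsub_apply, Finsupp.single_apply, mul_one]
  generalize d 0 = i
  generalize d 1 = j
  rcases i with _ | i
  · rcases j with _ | _ | j <;> simp
  rcases j with _ | _ | j
  · simp [ballot_succ_self]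
  · rcases i with _ | i
    · simp [ballot_zero]
    · have h := ballot_succ_succ (Nat.le_succ i)
      rw [Nat.succ_eq_add_one, ballot_self] at h
      simp [h]
  · simp
    rcases Nat.lt_or_ge j i with hji | hij
    · obtain ⟨k, rfl⟩ := Nat.exists_eq_add_of_lt hji
      have e₁ : j + k + 1 - (j + 1) = k := by omega
      cases k with
      | zero => simp [ballot_zero]
      | succ k =>
        have e₃ : j + (k + 1) + 1 - (j + 1 + 1) = k := by omega
        have h := ballot_succ_succ (i := j + (k + 1) + 1) (k := k) (by omega)
        simp [e₁, e₃, h]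
    · simp [hij.not_gt, (hij.trans j.le_succ).not_gt]
end

section
/- For every n ≥ 3, every set of pairwise non-crossing diagonals of the convex n-gon that is maximal under inclusion has exactly n−3 elements; in particular, every set of pairwise non-crossing diagonals has at most n−3 elements. -/
/-- `x` lies strictly inside the (clockwise) open arc from `a` to `b` on the convex `n`-gon
whose vertices are identified with `ZMod n` in cyclic order. -/
def Between (n : ℕ) (a x b : ZMod n) : Prop :=
  0 < (x - a).val ∧ (x - a).val < (b - a).val

/-- A diagonal of the convex `n`-gon: an unordered pair of distinct, non cyclically adjacent
vertices. -/
def IsDiagonal (n : ℕ) (p : Sym2 (ZMod n)) : Prop :=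
  ∃ a b : ZMod n, p = s(a, b) ∧ a ≠ b ∧ b ≠ a + 1 ∧ b ≠ a - 1

/-- Two diagonals cross iff their endpoints interleave in cyclic order: for some labelings
`p = {a,b}`, `q = {c,d}`, the vertex `c` lies strictly inside the arc from `a` to `b` and
`d` lies strictly inside the arc from `b` to `a`. -/
def Cross (n : ℕ) (p q : Sym2 (ZMod n)) : Prop :=
  ∃ a b c d : ZMod n, p = s(a, b) ∧ q = s(c, d) ∧ Between n a c b ∧ Between n b d a

/-- A triangulation of the convex `n`-gon: a set of `n − 3` pairwise non-crossing diagonals. -/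
def IsTriangulation (n : ℕ) (T : Finset (Sym2 (ZMod n))) : Prop :=
  T.card = n - 3 ∧ (∀ p ∈ T, IsDiagonal n p) ∧
    ∀ p ∈ T, ∀ q ∈ T, p ≠ q → ¬ Cross n p q

/-- The span-2 diagonal `e_i = {i−1, i+1}`. -/
def spanTwo (n : ℕ) (i : ZMod n) : Sym2 (ZMod n) := s(i - 1, i + 1)

/-- `T(n,m)`: the number of triangulations of the convex `n`-gon containing none of the span-2
diagonals `e_1, …, e_m`. -/
noncomputable def Tcount (n m : ℕ) : ℕ :=
  Set.ncard {T : Finset (Sym2 (ZMod n)) |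
    IsTriangulation n T ∧ ∀ k : ℕ, 1 ≤ k → k ≤ m → spanTwo n (k : ZMod n) ∉ T}

/-- A set of pairwise non-crossing diagonals of the convex `n`-gon. -/
def NonCrossingFamily (n : ℕ) (D : Finset (Sym2 (ZMod n))) : Prop :=
  (∀ p ∈ D, IsDiagonal n p) ∧ ∀ p ∈ D, ∀ q ∈ D, p ≠ q → ¬ Cross n p q

/-- A finite set of chords `(i, j)` with endpoints in the integer interval `[a, b]`, each joining
two non-consecutive points, no two of which straddle each other. The outer chord `(a, b)` is
allowed. -/
def IsArcSystem (a b : ℕ) (S : Finset (ℕ × ℕ)) : Prop :=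
  (∀ i j, (i, j) ∈ S → a ≤ i ∧ i + 2 ≤ j ∧ j ≤ b) ∧
    ∀ i j k l, (i, j) ∈ S → (k, l) ∈ S → ¬ (i < k ∧ k < j ∧ j < l)

/-- An arc system on an interval with at least one interior point has an interior point which is
covered by no arc other than possibly the outer one. -/
lemma IsArcSystem.exists_split {a b : ℕ} {S : Finset (ℕ × ℕ)} (hS : IsArcSystem a b S)
    (hab : a + 2 ≤ b) :
    ∃ m, a < m ∧ m < b ∧ ∀ i j, (i, j) ∈ S → (i, j) ≠ (a, b) → j ≤ m ∨ m ≤ i := by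
  obtain ⟨m, hm, hmax⟩ := Finset.exists_max_image
    ((Finset.Ioo a b).filter fun m => m = a + 1 ∨ (a, m) ∈ S) id ⟨a + 1, by simp; omega⟩
  simp only [Finset.mem_filter, Finset.mem_Ioo, id] at hm hmax
  refine ⟨m, hm.1.1, hm.1.2, fun i j hij hne => ?_⟩
  have hb := hS.1 i j hij
  by_contra! h
  rcases hm.2 with hm' | hm'
  · obtain rfl : i = a := by omega
    have hj : j ≠ b := by rintro rfl; exact hne rfl
    have := hmax j ⟨by omega, Or.inr hij⟩
    omega
  · by_cases hi : i = a
    · subst hi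
      have hj : j ≠ b := by rintro rfl; exact hne rfl
      have := hmax j ⟨by omega, Or.inr hij⟩
      omega
    · exact hS.2 a m i j hm' hij (by omega)

/-- Every arc system on `[a, b]` extends to one with `b - a - 1` arcs, one of them the outer arc
if `a + 2 ≤ b`. -/
lemma IsArcSystem.exists_extension {a b : ℕ} {S : Finset (ℕ × ℕ)} (hS : IsArcSystem a b S)
    (hab : a < b) :
    ∃ S', IsArcSystem a b S' ∧ S ⊆ S' ∧ S'.card + a + 1 = b ∧ (a + 2 ≤ b → (a, b) ∈ S') := by
  induction hd : b - a using Nat.strong_induction_on generalizing a b S with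
  | _ d ih =>
    by_cases h2 : a + 2 ≤ b
    · obtain ⟨m, ham, hmb, hm⟩ := hS.exists_split h2
      have h1 : IsArcSystem a m (S.filter fun p => p.2 ≤ m) := by
        refine ⟨fun i j h => ?_, fun i j k l h h' => hS.2 i j k l (Finset.mem_filter.1 h).1
          (Finset.mem_filter.1 h').1⟩
        have h := Finset.mem_filter.1 h
        have := hS.1 i j h.1
        exact ⟨this.1, this.2.1, h.2⟩
      have h2 : IsArcSystem m b (S.filter fun p => m ≤ p.1) := by
        refine ⟨fun i j h => ?_, fun i j k l h h' => hS.2 i j k l (Finset.mem_filter.1 h).1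
          (Finset.mem_filter.1 h').1⟩
        have h := Finset.mem_filter.1 h
        have := hS.1 i j h.1
        exact ⟨h.2, this.2⟩
      obtain ⟨S₁, hS₁, hsub₁, hcard₁, -⟩ := ih (m - a) (by omega) h1 ham rfl
      obtain ⟨S₂, hS₂, hsub₂, hcard₂, -⟩ := ih (b - m) (by omega) h2 hmb rfl
      have hdisj : Disjoint S₁ S₂ := by
        rw [Finset.disjoint_left]
        rintro ⟨i, j⟩ hi hj
        have := hS₁.1 i j hi
        have := hS₂.1 i j hj
        omega
      have hnot : (a, b) ∉ S₁ ∪ S₂ := by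
        intro h
        rcases Finset.mem_union.1 h with h | h
        · have := hS₁.1 _ _ h
          omega
        · have := hS₂.1 _ _ h
          omega
      refine ⟨insert (a, b) (S₁ ∪ S₂), ⟨fun i j h => ?_, fun i j k l h h' => ?_⟩, ?_, ?_,
        fun _ => Finset.mem_insert_self _ _⟩
      · simp only [Finset.mem_insert, Finset.mem_union, Prod.mk.injEq] at h
        rcases h with h | h | h
        · omega
        · have := hS₁.1 _ _ h
          omega
        · have := hS₂.1 _ _ h
          omega
      · simp only [Finset.mem_insert, Finset.mem_union, Prod.mk.injEq] at h h'
        rcases h with h | h | h <;> rcases h' with h' | h' | h'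
        · omega
        · have := hS₁.1 _ _ h'
          omega
        · have := hS₂.1 _ _ h'
          omega
        · have := hS₁.1 _ _ h
          omega
        · exact hS₁.2 i j k l h h'
        · have := hS₁.1 _ _ h
          have := hS₂.1 _ _ h'
          omega
        · have := hS₂.1 _ _ h
          omega
        · have := hS₂.1 _ _ h
          have := hS₁.1 _ _ h'
          omega
        · exact hS₂.2 i j k l h h'
      · rintro ⟨i, j⟩ h
        rw [Finset.mem_insert, Finset.mem_union]
        by_cases hne : (i, j) = (a, b)
        · exact Or.inl hne
        · rcases hm i j h hne with hj | hi
          · exact Or.inr (Or.inl (hsub₁ (Finset.mem_filter.2 ⟨h, hj⟩)))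
          · exact Or.inr (Or.inr (hsub₂ (Finset.mem_filter.2 ⟨h, hi⟩)))
      · rw [Finset.card_insert_of_notMem hnot, Finset.card_union_of_disjoint hdisj]
        omega
    · have hempty : S = ∅ := by
        rw [Finset.eq_empty_iff_forall_notMem]
        rintro ⟨i, j⟩ h
        have := hS.1 i j h
        omega
      refine ⟨S, hS, subset_rfl, ?_, fun h => absurd h h2⟩
      rw [hempty, Finset.card_empty]
      omega

lemma ZMod.val_sub_eq_ite {n : ℕ} [NeZero n] (x a : ZMod n) :
    (x - a).val = if a.val ≤ x.val then x.val - a.val else n + x.val - a.val := by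
  have hx := x.val_lt
  have ha := a.val_lt
  split_ifs with h
  · exact ZMod.val_sub h
  · have hcast : x - a = ((n + x.val - a.val : ℕ) : ZMod n) := by
      rw [Nat.cast_sub (by omega)]
      simp
    rw [hcast, ZMod.val_natCast, Nat.mod_eq_of_lt (by omega)]

lemma between_iff_val {n : ℕ} [NeZero n] (a x b : ZMod n) :
    Between n a x b ↔ (a.val < x.val ∧ x.val < b.val) ∨ (b.val < a.val ∧ a.val < x.val) ∨
      (x.val < b.val ∧ b.val < a.val) := by
  have hx := x.val_lt
  have ha := a.val_lt
  have hb := b.val_lt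
  unfold Between
  rw [ZMod.val_sub_eq_ite, ZMod.val_sub_eq_ite]
  split_ifs <;> omega

lemma ZMod.eq_add_one_iff_val {n : ℕ} [NeZero n] (hn : 2 ≤ n) (a b : ZMod n) :
    b = a + 1 ↔ b.val = a.val + 1 ∨ (b.val = 0 ∧ a.val + 1 = n) := by
  have : Fact (1 < n) := ⟨hn⟩
  have ha := a.val_lt
  have hb := b.val_lt
  rw [← sub_eq_iff_eq_add', ← (ZMod.val_injective n).eq_iff, ZMod.val_one, ZMod.val_sub_eq_ite]
  split_ifs <;> omega

lemma isDiagonal_iff_val {n : ℕ} [NeZero n] (hn : 2 ≤ n) (a b : ZMod n) (hab : a.val < b.val) :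
    IsDiagonal n s(a, b) ↔ a.val + 2 ≤ b.val ∧ ¬ (a.val = 0 ∧ b.val + 1 = n) := by
  have key : ∀ c d : ZMod n, (c ≠ d ∧ d ≠ c + 1 ∧ d ≠ c - 1) ↔
      c.val ≠ d.val ∧ ¬ (d.val = c.val + 1 ∨ (d.val = 0 ∧ c.val + 1 = n)) ∧
        ¬ (c.val = d.val + 1 ∨ (c.val = 0 ∧ d.val + 1 = n)) := by
    intro c d
    rw [← ZMod.eq_add_one_iff_val hn, ← ZMod.eq_add_one_iff_val hn, ne_eq, ne_eq, ne_eq, ne_eq,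
      (ZMod.val_injective n).eq_iff, eq_sub_iff_add_eq, eq_comm (a := d + 1)]
  have hb := b.val_lt
  constructor
  · rintro ⟨c, d, h, hcd⟩
    rw [key] at hcd
    rcases Sym2.eq_iff.1 h with ⟨rfl, rfl⟩ | ⟨rfl, rfl⟩ <;> omega
  · intro h
    refine ⟨a, b, rfl, (key a b).2 ?_⟩
    omega

lemma cross_iff_val {n : ℕ} [NeZero n] (a b c d : ZMod n) (hab : a.val < b.val)
    (hcd : c.val < d.val) :
    Cross n s(a, b) s(c, d) ↔ (a.val < c.val ∧ c.val < b.val ∧ b.val < d.val) ∨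
      (c.val < a.val ∧ a.val < d.val ∧ d.val < b.val) := by
  constructor
  · rintro ⟨a', b', c', d', h, h', hc, hd⟩
    rw [between_iff_val] at hc hd
    rcases Sym2.eq_iff.1 h with ⟨rfl, rfl⟩ | ⟨rfl, rfl⟩ <;>
      rcases Sym2.eq_iff.1 h' with ⟨rfl, rfl⟩ | ⟨rfl, rfl⟩ <;> omega
  · rintro (h | h)
    · refine ⟨a, b, c, d, rfl, rfl, ?_, ?_⟩ <;> rw [between_iff_val] <;> omega
    · refine ⟨a, b, d, c, rfl, Sym2.eq_swap, ?_, ?_⟩ <;> rw [between_iff_val] <;> omega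

/-- Every non-crossing family of diagonals extends to one with `n - 3` elements. -/
lemma NonCrossingFamily.exists_extension {n : ℕ} (hn : 3 ≤ n) {D : Finset (Sym2 (ZMod n))}
    (hD : NonCrossingFamily n D) :
    ∃ D', NonCrossingFamily n D' ∧ D ⊆ D' ∧ D'.card = n - 3 := by
  classical
  have : NeZero n := ⟨by omega⟩
  have val_cast : ∀ i, i < n → (i : ZMod n).val = i := fun i h => ZMod.val_cast_of_lt h
  let f : ℕ × ℕ → Sym2 (ZMod n) := fun p => s((p.1 : ZMod n), (p.2 : ZMod n))
  let S := ((Finset.range n ×ˢ Finset.range n).filter fun p => p.1 < p.2 ∧ f p ∈ D)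
  have mem_S : ∀ i j, (i, j) ∈ S ↔ i < j ∧ j < n ∧ s((i : ZMod n), (j : ZMod n)) ∈ D := by
    intro i j
    simp only [S, f, Finset.mem_filter, Finset.mem_product, Finset.mem_range]
    constructor
    · tauto
    · rintro ⟨h1, h2, h3⟩
      exact ⟨⟨by omega, h2⟩, h1, h3⟩
  have diag : ∀ i j, i < j → j < n → (IsDiagonal n s((i : ZMod n), (j : ZMod n)) ↔
      i + 2 ≤ j ∧ ¬ (i = 0 ∧ j + 1 = n)) := by
    intro i j hij hj
    have := isDiagonal_iff_val (n := n) (by omega) i j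
    rw [val_cast i (by omega), val_cast j hj] at this
    exact this hij
  have cross : ∀ i j k l, i < j → j < n → k < l → l < n →
      (Cross n s((i : ZMod n), (j : ZMod n)) s((k : ZMod n), (l : ZMod n)) ↔
      (i < k ∧ k < j ∧ j < l) ∨ (k < i ∧ i < l ∧ l < j)) := by
    intro i j k l hij hj hkl hl
    have := cross_iff_val (n := n) i j k l
    rw [val_cast i (by omega), val_cast j hj, val_cast k (by omega), val_cast l hl] at this
    exact this hij hkl
  have f_inj : ∀ i j k l, i < j → j < n → k < l → l < n → f (i, j) = f (k, l) →
      i = k ∧ j = l := by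
    intro i j k l hij hj hkl hl h
    rcases Sym2.eq_iff.1 h with ⟨h1, h2⟩ | ⟨h1, h2⟩ <;>
    · have h1 := congrArg ZMod.val h1
      have h2 := congrArg ZMod.val h2
      simp only at h1 h2
      rw [val_cast _ (by omega), val_cast _ (by omega)] at h1 h2
      omega
  have hS : IsArcSystem 0 (n - 1) S := by
    refine ⟨fun i j h => ?_, fun i j k l h h' hlt => ?_⟩
    · obtain ⟨hij, hj, hmem⟩ := (mem_S i j).1 h
      have := (diag i j hij hj).1 (hD.1 _ hmem)
      omega
    · obtain ⟨hij, hj, hmem⟩ := (mem_S i j).1 h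
      obtain ⟨hkl, hl, hmem'⟩ := (mem_S k l).1 h'
      refine hD.2 _ hmem _ hmem' (fun heq => ?_) ((cross i j k l hij hj hkl hl).2 (Or.inl hlt))
      have := f_inj i j k l hij hj hkl hl heq
      omega
  obtain ⟨S', hS', hsub, hcard, houter⟩ := hS.exists_extension (by omega)
  have hbound : ∀ i j, (i, j) ∈ S' → i < j ∧ j < n := by
    intro i j h
    have := hS'.1 i j h
    omega
  refine ⟨(S'.erase (0, n - 1)).image f, ⟨?_, ?_⟩, ?_, ?_⟩
  · intro p hp
    obtain ⟨⟨i, j⟩, h, rfl⟩ := Finset.mem_image.1 hp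
    rw [Finset.mem_erase, ne_eq, Prod.mk.injEq] at h
    obtain ⟨hij, hj⟩ := hbound i j h.2
    have := hS'.1 i j h.2
    exact (diag i j hij hj).2 (by omega)
  · intro p hp q hq _ hc
    obtain ⟨⟨i, j⟩, h, rfl⟩ := Finset.mem_image.1 hp
    obtain ⟨⟨k, l⟩, h', rfl⟩ := Finset.mem_image.1 hq
    have h := Finset.mem_of_mem_erase h
    have h' := Finset.mem_of_mem_erase h'
    obtain ⟨hij, hj⟩ := hbound i j h
    obtain ⟨hkl, hl⟩ := hbound k l h'
    rcases (cross i j k l hij hj hkl hl).1 hc with hc | hc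
    · exact hS'.2 i j k l h h' hc
    · exact hS'.2 k l i j h' h hc
  · have aux : ∀ a b : ZMod n, a.val < b.val → s(a, b) ∈ D →
        s(a, b) ∈ (S'.erase (0, n - 1)).image f := by
      intro a b hab hmem
      refine Finset.mem_image.2 ⟨(a.val, b.val), Finset.mem_erase.2 ⟨?_, hsub ?_⟩, by simp [f]⟩
      · have := (isDiagonal_iff_val (by omega) a b hab).1 (hD.1 _ hmem)
        rw [ne_eq, Prod.mk.injEq]
        omega
      · rw [mem_S]
        exact ⟨hab, b.val_lt, by simpa using hmem⟩
    intro p hp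
    obtain ⟨a, b, rfl, hne, -⟩ := hD.1 p hp
    rcases lt_or_gt_of_ne (fun h => hne (ZMod.val_injective n h)) with h | h
    · exact aux a b h hp
    · rw [Sym2.eq_swap] at hp ⊢
      exact aux b a h hp
  · rw [Finset.card_image_of_injOn, Finset.card_erase_of_mem (houter (by omega))]
    · omega
    · rintro ⟨i, j⟩ h ⟨k, l⟩ h' heq
      obtain ⟨hij, hj⟩ := hbound i j (Finset.mem_of_mem_erase h)
      obtain ⟨hkl, hl⟩ := hbound k l (Finset.mem_of_mem_erase h')
      exact Prod.mk.injEq .. ▸ f_inj i j k l hij hj hkl hl heq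

/-- For `n ≥ 3`, every inclusion-maximal set of pairwise non-crossing diagonals of the convex
`n`-gon has exactly `n − 3` elements; in particular every set of pairwise non-crossing diagonals
has at most `n − 3` elements. -/
theorem maximal_noncrossing_card (n : ℕ) (hn : 3 ≤ n) :
    (∀ D : Finset (Sym2 (ZMod n)), NonCrossingFamily n D →
      (∀ D' : Finset (Sym2 (ZMod n)), NonCrossingFamily n D' → D ⊆ D' → D' = D) →
      D.card = n - 3) ∧
    (∀ D : Finset (Sym2 (ZMod n)), NonCrossingFamily n D → D.card ≤ n - 3) := by
  refine ⟨fun D hD hmax => ?_, fun D hD => ?_⟩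
  · obtain ⟨D', hD', hsub, hcard⟩ := hD.exists_extension hn
    rw [← hmax D' hD' hsub, hcard]
  · obtain ⟨D', -, hsub, hcard⟩ := hD.exists_extension hn
    exact hcard ▸ Finset.card_le_card hsub
end
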